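/- arXiv:2403.08537 — 2 statements merged into one kernel-verified Lean document; each statement's English description precedes it below -/
import Mathlib

section
/- The Terwilliger F-algebra T of the factorial scheme with parameters u_1,…,u_n is semisimple if and only if the characteristic p of F does not divide u_i − 1 for any i ∈ {1,…,n} (equivalently, p ∤ k_S = ∏_{x∈S}(u_x − 1) for every subset S). -/
open Finset

variable {n : ℕ} {U : Fin n → Type*} [∀ i, Fintype (U i)] [∀ i, DecidableEq (U i)]
variable (F : Type*) [Field F]

/-- `D(y,z) = {i : y i ≠ z i}`. -/
def Dst (y z : ∀ i, U i) : Finset (Fin n) := univ.filter (fun i => y i ≠ z i)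

/-- Adjacency matrix of the relation indexed by `S`. -/
def adjMat (S : Finset (Fin n)) : Matrix (∀ i, U i) (∀ i, U i) F :=
  fun y z => if Dst y z = S then 1 else 0

/-- Dual idempotent with respect to the base point `x`. -/
def dualIdem (x : ∀ i, U i) (S : Finset (Fin n)) : Matrix (∀ i, U i) (∀ i, U i) F :=
  Matrix.diagonal (fun y => if Dst x y = S then 1 else 0)

/-- The Terwilliger `F`-algebra of the factorial scheme with base point `x`. -/
def TerwAlg (x : ∀ i, U i) : Subalgebra F (Matrix (∀ i, U i) (∀ i, U i) F) :=
  Algebra.adjoin F (Set.range (adjMat F) ∪ Set.range (dualIdem F x))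


theorem semi_of_idem {R ι : Type*} [Ring R] [IsArtinianRing R] [Fintype ι] (e : ι → R)
    (h1 : ∑ a, e a = 1) (he : ∀ a, e a * e a = e a)
    (hr : ∀ a b r, e a * r * e b = 0 ∨ ∃ s, e a * r * e b * s = e a) : IsSemisimpleRing R := by
  rw [IsArtinianRing.isSemisimpleRing_iff_jacobson, eq_bot_iff]
  intro r hrJ
  have key : ∀ a b, e a * r * e b = 0 := by
    intro a b
    rcases hr a b r with h | ⟨s, hs⟩
    · exact h
    · have hm : e a * r * e b * s ∈ Ring.jacobson R :=
        Ideal.mul_mem_right _ _ (Ideal.mul_mem_right _ _ (Ideal.mul_mem_left _ _ hrJ))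
      rw [hs, ← Ideal.jacobson_bot, Ideal.mem_jacobson_iff] at hm
      obtain ⟨z, hz⟩ := hm (-1)
      have hz' : z * -1 * e a + z - 1 = 0 := by simpa using hz
      have : e a = 0 := by
        have h3 : (z * -1 * e a + z - 1) * e a = 0 := by rw [hz', zero_mul]
        have h4 : (z * -1 * e a + z - 1) * e a = - (z * (e a * e a)) + z * e a - e a := by
          noncomm_ring
        rw [h4, he] at h3
        simpa using h3
      simp [this]
  have : r = ∑ a, ∑ b, e a * r * e b := by
    simp_rw [← Finset.mul_sum, h1, mul_one, ← Finset.sum_mul, h1, one_mul]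
  simp only [key, Finset.sum_const_zero] at this
  simp [this]

theorem not_semi {R : Type*} [Ring R] [IsSemisimpleRing R] (a : R) (h : ∀ r, a * r * a = 0) :
    a = 0 := by
  have : a ∈ Ring.jacobson R := by
    rw [← Ideal.jacobson_bot, Ideal.mem_jacobson_iff]
    intro y
    refine ⟨1 - y * a, ?_⟩
    have h4 : (1 - y * a) * y * a + (1 - y * a) - 1 = - (y * (a * y * a)) := by noncomm_ring
    rw [h4, h]; simp
  rw [IsSemisimpleRing.jacobson_eq_bot] at this
  simpa using this

section loc
variable {K : Type*} [Field K]
variable {V : Type*} [Fintype V] [DecidableEq V]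

def lf (x : V) : Bool → V → K
  | false => fun y => if y = x then 1 else 0
  | true => fun y => if y = x then 0 else 1

variable (K) in
def lw (V : Type*) [Fintype V] : Bool → K
  | false => 1
  | true => (Fintype.card V : K) - 1

theorem lf_dot (x : V) (a b : Bool) :
    (lf x a : V → K) ⬝ᵥ lf x b = if a = b then lw K V a else 0 := by
  have h0 : (lf x true : V → K) ⬝ᵥ lf x true = lw K V true := by
    have : ∀ y, (lf x true y : K) * lf x true y = 1 - if y = x then 1 else 0 := by
      intro y; simp only [lf]; split_ifs <;> simp
    simp only [dotProduct, this, Finset.sum_sub_distrib]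
    simp [lw]
  cases a <;> cases b
  · simp [dotProduct, lf, lw]
  · simp only [dotProduct, lf]
    simpa using Finset.sum_eq_zero (by intros; split_ifs <;> rfl)
  · simp [dotProduct, lf]
  · simpa using h0

variable (K) in
def le2 (x : V) : Matrix V V K :=
  1 - ∑ a, (lw K V a)⁻¹ • Matrix.vecMulVec (lf x a) (lf x a)

variable (K) in
def lv (x : V) : Option Bool → Option Bool → Matrix V V K
  | some a, some b => Matrix.vecMulVec (lf x a) (lf x b)
  | none, none => le2 K x
  | _, _ => 0

variable (K) in
def le (x : V) : Option Bool → Matrix V V K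
  | some a => (lw K V a)⁻¹ • lv K x (some a) (some a)
  | none => le2 K x

theorem lv_mul (x : V) (a b c d : Bool) : lv K x (some a) (some b) * lv K x (some c) (some d)
    = (if b = c then lw K V b else 0) • lv K x (some a) (some d) := by
  simp only [lv, Matrix.vecMulVec_mul_vecMulVec, lf_dot]
  split_ifs <;> simp [Matrix.vecMulVec_smul]

theorem le2_mul (hw : ∀ a, lw K V a ≠ 0) (x : V) (c d : Bool) :
    le2 K x * lv K x (some c) (some d) = 0 := by
  have : le2 K x = 1 - ∑ a, (lw K V a)⁻¹ • lv K x (some a) (some a) := rfl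
  rw [this, sub_mul, Finset.sum_mul]
  simp only [smul_mul_assoc, lv_mul, smul_smul, one_mul]
  cases c <;> simp [hw]

theorem mul_le2 (hw : ∀ a, lw K V a ≠ 0) (x : V) (c d : Bool) :
    lv K x (some c) (some d) * le2 K x = 0 := by
  have : le2 K x = 1 - ∑ a, (lw K V a)⁻¹ • lv K x (some a) (some a) := rfl
  rw [this, mul_sub, Finset.mul_sum]
  simp only [mul_smul_comm, lv_mul, smul_smul, mul_one]
  cases d <;> simp [hw]

theorem le2_le2 (hw : ∀ a, lw K V a ≠ 0) (x : V) : le2 K x * le2 K x = le2 K x := by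
  have : le2 K x = 1 - ∑ a, (lw K V a)⁻¹ • lv K x (some a) (some a) := rfl
  have h2 : le2 K x * le2 K x =
      (1 - ∑ a, (lw K V a)⁻¹ • lv K x (some a) (some a)) * le2 K x := by rw [← this]
  rw [h2, sub_mul, Finset.sum_mul]
  simp only [smul_mul_assoc, mul_le2 hw, smul_zero, Finset.sum_const_zero, sub_zero, one_mul]

theorem lv_nn (x : V) : lv K x none none = le2 K x := rfl
theorem lv_ns (x : V) (a) : lv K x none (some a) = 0 := rfl
theorem lv_sn (x : V) (a) : lv K x (some a) none = 0 := rfl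
theorem le_n (x : V) : le K x none = le2 K x := rfl
theorem le_s (x : V) (a) : le K x (some a) = (lw K V a)⁻¹ • lv K x (some a) (some a) := rfl

theorem le_sum (x : V) : ∑ a, le K x a = 1 := by
  simp [Fintype.sum_option, le_n, le_s, le2, lv]

theorem le_idem (hw : ∀ a, lw K V a ≠ 0) (x : V) (a) : le K x a * le K x a = le K x a := by
  rcases a with _ | a
  · simp [le_n, le2_le2 hw]
  · simp [le_s, lv_mul, hw]

theorem lv_lv (hw : ∀ a, lw K V a ≠ 0) (x : V) (a b c) :
    ∃ t : K, lv K x a b * lv K x b c = t • lv K x a c := by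
  rcases a with _ | a <;> rcases b with _ | b <;> rcases c with _ | c <;>
    simp only [lv_nn, lv_ns, lv_sn, lv_mul, le2_le2 hw, mul_zero, zero_mul] <;>
  first | (refine ⟨0, ?_⟩; rw [zero_smul]; done) | (refine ⟨1, ?_⟩; rw [one_smul]; done) | exact ⟨_, rfl⟩

theorem lv_inv (hw : ∀ a, lw K V a ≠ 0) (x : V) (a b) :
    lv K x a b = 0 ∨ ∃ t : K, lv K x a b * (t • lv K x b a) = le K x a := by
  rcases a with _ | a <;> rcases b with _ | b <;>
    simp only [lv_nn, lv_ns, lv_sn, lv_mul, le2_le2 hw, le_n, le_s, mul_zero, zero_mul, mul_smul_comm,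
      true_or]
  · exact Or.inr ⟨1, by simp⟩
  · refine Or.inr ⟨(lw K V a)⁻¹ * (lw K V b)⁻¹, ?_⟩
    simp [smul_smul, hw]

def lJ : Matrix V V K := Matrix.of fun _ _ => 1
def lE (x : V) : Matrix V V K := Matrix.of fun y z => if y = z ∧ y = x then 1 else 0

theorem lE_eq (x : V) : lE x = lv K x (some false) (some false) := by
  ext y z
  simp only [lE, lv, lf, Matrix.vecMulVec_apply, Matrix.of_apply]
  split_ifs <;> grind

theorem lJ_eq (x : V) : lJ = ∑ a, ∑ b, lv K x (some a) (some b) := by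
  ext y z
  simp only [lJ, lv, lf, Fintype.sum_bool, Matrix.add_apply, Matrix.vecMulVec_apply, Matrix.of_apply]
  split_ifs <;> simp

def LP (x : V) (M : Matrix V V K) : Prop := ∀ a b, ∃ t : K, le K x a * M * le K x b = t • lv K x a b

theorem LP.sub {x : V} {M N : Matrix V V K} (h : LP x M) (h' : LP x N) : LP x (M - N) := by
  intro a b
  obtain ⟨t, ht⟩ := h a b
  obtain ⟨s, hs⟩ := h' a b
  exact ⟨t - s, by rw [mul_sub, sub_mul, ht, hs, sub_smul]⟩

theorem LP.add {x : V} {M N : Matrix V V K} (h : LP x M) (h' : LP x N) : LP x (M + N) := by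
  intro a b
  obtain ⟨t, ht⟩ := h a b
  obtain ⟨s, hs⟩ := h' a b
  exact ⟨t + s, by rw [mul_add, add_mul, ht, hs, add_smul]⟩

theorem LP_one (hw : ∀ a, lw K V a ≠ 0) (x : V) : LP x (1 : Matrix V V K) := by
  intro a b
  rcases a with _ | a <;> rcases b with _ | b <;>
    simp only [le_n, le_s, mul_one, smul_mul_assoc, mul_smul_comm, le2_le2 hw, le2_mul hw,
      mul_le2 hw, smul_zero, lv_nn, lv_mul, smul_smul]
  · exact ⟨1, by simp⟩
  · exact ⟨0, by simp⟩
  · exact ⟨0, by simp⟩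
  · exact ⟨_, rfl⟩

theorem LP_v (hw : ∀ a, lw K V a ≠ 0) (x : V) (c d) : LP x (lv K x (some c) (some d)) := by
  intro a b
  rcases a with _ | a <;> rcases b with _ | b <;>
    simp only [le_n, le_s, mul_one, smul_mul_assoc, mul_smul_comm, le2_le2 hw, le2_mul hw,
      mul_le2 hw, smul_zero, lv_nn, lv_mul, smul_smul, zero_mul]
  · exact ⟨0, by simp⟩
  · exact ⟨0, by simp⟩
  · exact ⟨0, by simp⟩
  · exact ⟨_, rfl⟩

theorem LP_E (hw : ∀ a, lw K V a ≠ 0) (x : V) : LP x (lE x : Matrix V V K) := by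
  rw [lE_eq]; exact LP_v hw _ _ _

theorem LP_J (hw : ∀ a, lw K V a ≠ 0) (x : V) : LP x (lJ : Matrix V V K) := by
  rw [lJ_eq x]; simp only [Fintype.sum_bool]
  exact ((LP_v hw _ _ _).add (LP_v hw _ _ _)).add ((LP_v hw _ _ _).add (LP_v hw _ _ _))

variable (K) in
def lT (x : V) : Subalgebra K (Matrix V V K) := Algebra.adjoin K {lJ, lE x}

theorem lJ_mem (x : V) : lJ ∈ lT K x := Algebra.subset_adjoin (by simp)
theorem lE_mem (x : V) : lE x ∈ lT K x := Algebra.subset_adjoin (by simp)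

theorem lv_mem (x : V) (a b) : lv K x a b ∈ lT K x := by
  have hs : ∀ a b, lv K x (some a) (some b) ∈ lT K x := by
    have hp : ∀ a : Bool, ∃ P ∈ lT K x, P.mulVec (fun _ => 1) = lf x a ∧
        Matrix.vecMul (fun _ => 1) P = lf x a := by
      intro a
      have h0 : (lE x : Matrix V V K).mulVec (fun _ => 1) = lf x false := by
        ext y; simp [lE, Matrix.mulVec, dotProduct, lf, ite_and]
      have h0' : Matrix.vecMul (fun _ => 1) (lE x : Matrix V V K) = lf x false := by
        ext y; simp [lE, Matrix.vecMul, dotProduct, lf, ite_and]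
      have h1 : (fun _ => 1 : V → K) - lf x false = lf x true := by
        ext y; simp only [lf, Pi.sub_apply]; split_ifs <;> simp
      cases a
      · exact ⟨lE x, lE_mem x, h0, h0'⟩
      · exact ⟨1 - lE x, sub_mem (one_mem _) (lE_mem x), by
          rw [Matrix.sub_mulVec, h0, Matrix.one_mulVec, h1], by
          rw [Matrix.vecMul_sub, h0', Matrix.vecMul_one, h1]⟩
    intro a b
    obtain ⟨P, hP, hP1, -⟩ := hp a
    obtain ⟨Q, hQ, -, hQ2⟩ := hp b
    have : lv K x (some a) (some b) = P * lJ * Q := by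
      have hJ : (lJ : Matrix V V K) = Matrix.vecMulVec (fun _ => 1) (fun _ => 1) := by
        ext; simp [lJ, Matrix.vecMulVec_apply]
      rw [hJ, Matrix.mul_vecMulVec, Matrix.vecMulVec_mul, hP1, hQ2]; rfl
    rw [this]
    exact mul_mem (mul_mem hP (lJ_mem x)) hQ
  rcases a with _ | a <;> rcases b with _ | b
  · exact sub_mem (one_mem _) (sum_mem fun a _ => Subalgebra.smul_mem _ (hs a a) _)
  · exact zero_mem _
  · exact zero_mem _
  · exact hs a b

theorem le_mem (x : V) (a) : le K x a ∈ lT K x := by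
  rcases a with _ | a
  · exact lv_mem x none none
  · exact Subalgebra.smul_mem _ (lv_mem x _ _) _

end loc

section tens
variable {K : Type*} [Field K]
variable {n : ℕ} {U : Fin n → Type*} [∀ i, Fintype (U i)] [∀ i, DecidableEq (U i)]

def tens (M : ∀ i, Matrix (U i) (U i) K) : Matrix (∀ i, U i) (∀ i, U i) K :=
  Matrix.of fun y z => ∏ i, M i (y i) (z i)

theorem tens_mul (M N : ∀ i, Matrix (U i) (U i) K) :
    tens M * tens N = tens (fun i => M i * N i) := by
  ext y z
  simp only [tens, Matrix.mul_apply, Matrix.of_apply, ← Finset.prod_mul_distrib]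
  rw [Finset.prod_univ_sum, Fintype.piFinset_univ]

theorem tens_smul (c : Fin n → K) (M : ∀ i, Matrix (U i) (U i) K) :
    tens (fun i => c i • M i) = (∏ i, c i) • tens M := by
  ext y z
  simp [tens, Finset.prod_mul_distrib]

theorem tens_one : tens (fun i => (1 : Matrix (U i) (U i) K)) = 1 := by
  ext y z
  simp only [tens, Matrix.of_apply, Matrix.one_apply]
  rw [Finset.prod_ite_zero]
  simp [funext_iff]

theorem tens_zero (M : ∀ i, Matrix (U i) (U i) K) (i) (h : M i = 0) : tens M = 0 := by
  ext y z
  simp only [tens, Matrix.of_apply, Matrix.zero_apply]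
  exact Finset.prod_eq_zero (mem_univ i) (by simp [h])

theorem tens_sum {ι : Type*} [Fintype ι] [DecidableEq ι] (e : ∀ i, ι → Matrix (U i) (U i) K) :
    tens (fun i => ∑ a, e i a) = ∑ α : Fin n → ι, tens (fun i => e i (α i)) := by
  ext y z
  simp only [tens, Matrix.of_apply, Matrix.sum_apply]
  rw [Finset.prod_univ_sum, Fintype.piFinset_univ]

def tI (i : Fin n) (M : Matrix (U i) (U i) K) : Matrix (∀ i, U i) (∀ i, U i) K :=
  tens (Function.update (fun j => (1 : Matrix (U j) (U j) K)) i M)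

theorem tI_apply (i : Fin n) (M : Matrix (U i) (U i) K) (y z) :
    tI i M y z = M (y i) (z i) * ∏ j ∈ univ.erase i, (1 : Matrix (U j) (U j) K) (y j) (z j) := by
  simp only [tI, tens, Matrix.of_apply]
  rw [← Finset.mul_prod_erase univ _ (mem_univ i)]
  congr 1
  · simp
  · apply Finset.prod_congr rfl
    intro j hj
    rw [Function.update_of_ne (Finset.ne_of_mem_erase hj)]

theorem tI_add (i : Fin n) (M N : Matrix (U i) (U i) K) : tI i (M + N) = tI i M + tI i N := by
  ext y z; simp [tI_apply, add_mul]

theorem tI_smul (i : Fin n) (c : K) (M : Matrix (U i) (U i) K) : tI i (c • M) = c • tI i M := by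
  ext y z; simp [tI_apply, mul_assoc]

theorem tI_one (i : Fin n) : tI i (1 : Matrix (U i) (U i) K) = 1 := by
  simp [tI, tens_one]

theorem tI_mul (i : Fin n) (M N : Matrix (U i) (U i) K) : tI i (M * N) = tI i M * tI i N := by
  simp only [tI, tens_mul]
  congr 1; ext1 j
  by_cases h : j = i
  · subst h; simp
  · simp [Function.update_of_ne h]

theorem adjMat_eq (S : Finset (Fin n)) :
    adjMat K S = tens (fun i => if i ∈ S then (lJ - 1 : Matrix (U i) (U i) K) else 1) := by
  ext y z
  have : ∀ i, (if i ∈ S then (lJ - 1 : Matrix (U i) (U i) K) else 1) (y i) (z i) =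
      if (y i ≠ z i ↔ i ∈ S) then 1 else 0 := by
    intro i
    by_cases h : i ∈ S <;> by_cases h' : y i = z i <;> simp [h, h', lJ, Matrix.one_apply]
  simp only [tens, Matrix.of_apply, this, adjMat]
  rw [Finset.prod_ite_zero]
  simp [Dst, Finset.ext_iff]

theorem dualIdem_eq (x : ∀ i, U i) (S : Finset (Fin n)) :
    dualIdem K x S = tens (fun i => if i ∈ S then (1 - lE (x i) : Matrix (U i) (U i) K) else lE (x i)) := by
  ext y z
  have : ∀ i, (if i ∈ S then (1 - lE (x i) : Matrix (U i) (U i) K) else lE (x i)) (y i) (z i) =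
      if (y i = z i ∧ (x i ≠ y i ↔ i ∈ S)) then 1 else 0 := by
    intro i
    by_cases h : i ∈ S <;> by_cases h' : y i = z i <;> by_cases h'' : x i = y i <;>
      simp [h, h', h'', lE, Matrix.one_apply] <;> grind
  simp only [tens, Matrix.of_apply, this, dualIdem, Matrix.diagonal_apply]
  rw [Finset.prod_ite_zero]
  simp [Dst, Finset.ext_iff, funext_iff, forall_and, ite_and]

theorem tI_J_mem (x : ∀ i, U i) (i : Fin n) : tI i lJ ∈ TerwAlg K x := by
  have h1 : ∀ S, adjMat K S ∈ TerwAlg K x := fun S => Algebra.subset_adjoin (Or.inl ⟨S, rfl⟩)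
  have : tI i lJ = 1 + adjMat K (U := U) {i} := by
    have : (lJ : Matrix (U i) (U i) K) = 1 + (lJ - 1) := by simp
    rw [this, tI_add, tI_one, adjMat_eq, tI]
    congr 2
    funext j
    by_cases h : j = i
    · subst h; simp
    · simp [h]
  rw [this]
  exact add_mem (one_mem _) (h1 _)

theorem tI_E_mem (x : ∀ i, U i) (i : Fin n) : tI i (lE (x i)) ∈ TerwAlg K x := by
  have h1 : ∀ S, dualIdem K x S ∈ TerwAlg K x := fun S => Algebra.subset_adjoin (Or.inr ⟨S, rfl⟩)
  have : tI i (lE (x i)) = ∑ S ∈ univ.filter (fun S => i ∉ S), dualIdem K x S := by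
    ext y z
    simp only [tI_apply, Matrix.sum_apply, dualIdem, Matrix.diagonal_apply, Matrix.one_apply,
      Finset.prod_ite_zero, lE, Matrix.of_apply]
    by_cases hyz : y = z
    · subst hyz
      simp [Finset.sum_filter, Dst, eq_comm]
    · simp only [hyz, if_false, Finset.sum_const_zero]
      obtain ⟨j, hj⟩ := Function.ne_iff.1 hyz
      by_cases h : j = i
      · subst h; simp [hj]
      · rw [if_neg (c := ∀ k ∈ univ.erase i, y k = z k), mul_zero]
        intro H
        exact hj (H j (by simp [h]))
  rw [this]
  exact sum_mem fun S _ => h1 S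

theorem tI_mem (x : ∀ i, U i) (i : Fin n) {M : Matrix (U i) (U i) K} (hM : M ∈ lT K (x i)) :
    tI i M ∈ TerwAlg K x := by
  induction hM using Algebra.adjoin_induction with
  | mem M h =>
    rcases h with rfl | rfl
    · exact tI_J_mem x i
    · exact tI_E_mem x i
  | algebraMap r =>
    rw [Algebra.algebraMap_eq_smul_one, tI_smul, tI_one]
    exact Subalgebra.smul_mem _ (one_mem _) _
  | add M N _ _ h1 h2 => rw [tI_add]; exact add_mem h1 h2
  | mul M N _ _ h1 h2 => rw [tI_mul]; exact mul_mem h1 h2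

theorem tens_mem (x : ∀ i, U i) {M : ∀ i, Matrix (U i) (U i) K} (hM : ∀ i, M i ∈ lT K (x i)) :
    tens M ∈ TerwAlg K x := by
  have : ∀ s : Finset (Fin n), tens (fun i => if i ∈ s then M i else 1) ∈ TerwAlg K x := by
    intro s
    induction s using Finset.induction_on with
    | empty => simp [tens_one, one_mem]
    | insert a s ha ih =>
      have : tens (fun i => if i ∈ insert a s then M i else 1) =
          tens (fun i => if i ∈ s then M i else 1) * tI a (M a) := by
        rw [tI, tens_mul]
        congr 1; ext1 j
        by_cases h : j = a
        · subst h; simp [ha]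
        · simp [h]
      rw [this]
      exact mul_mem ih (tI_mem x a (hM a))
  simpa using this univ

theorem semi (x : ∀ i, U i) (hw : ∀ i a, lw K (U i) a ≠ 0) : IsSemisimpleRing (TerwAlg K x) := by
  have : IsArtinianRing (TerwAlg K x) := IsArtinianRing.of_finite K _
  let e : (Fin n → Option Bool) → Matrix (∀ i, U i) (∀ i, U i) K :=
    fun α => tens fun i => le K (x i) (α i)
  let v : (Fin n → Option Bool) → (Fin n → Option Bool) → Matrix (∀ i, U i) (∀ i, U i) K :=
    fun α β => tens fun i => lv K (x i) (α i) (β i)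
  have hsum : ∑ α, e α = 1 := by
    rw [← tens_sum (fun i a => le K (x i) a)]
    simp only [le_sum, tens_one]
  have hidem : ∀ α, e α * e α = e α := by
    intro α
    simp only [e, tens_mul, le_idem (hw _)]
  have hvv : ∀ α β γ, ∃ t : K, v α β * v β γ = t • v α γ := by
    intro α β γ
    choose t ht using fun i => lv_lv (hw i) (x i) (α i) (β i) (γ i)
    exact ⟨∏ i, t i, by simp only [v, tens_mul, ht, tens_smul]⟩
  have hgen : ∀ M : ∀ i, Matrix (U i) (U i) K, (∀ i, LP (x i) (M i)) →
      ∀ α β, ∃ t : K, e α * tens M * e β = t • v α β := by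
    intro M hM α β
    choose t ht using fun i => hM i (α i) (β i)
    exact ⟨∏ i, t i, by simp only [e, v, tens_mul, ht, tens_smul]⟩
  have hall : ∀ r ∈ TerwAlg K x, ∀ α β, ∃ t : K, e α * r * e β = t • v α β := by
    intro r hr
    induction hr using Algebra.adjoin_induction with
    | mem M h =>
      rcases h with ⟨S, rfl⟩ | ⟨S, rfl⟩
      · rw [adjMat_eq]
        apply hgen
        intro i
        split_ifs
        · exact (LP_J (hw i) _).sub (LP_one (hw i) _)
        · exact LP_one (hw i) _
      · rw [dualIdem_eq]
        apply hgen
        intro i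
        split_ifs
        · exact (LP_one (hw i) _).sub (LP_E (hw i) _)
        · exact LP_E (hw i) _
    | algebraMap r =>
      intro α β
      obtain ⟨t, ht⟩ := hgen (fun i => 1) (fun i => LP_one (hw i) _) α β
      rw [tens_one] at ht
      refine ⟨r * t, ?_⟩
      rw [Algebra.algebraMap_eq_smul_one, mul_smul_comm, smul_mul_assoc, ht, smul_smul]
    | add M N _ _ h1 h2 =>
      intro α β
      obtain ⟨t, ht⟩ := h1 α β
      obtain ⟨s, hs⟩ := h2 α β
      exact ⟨t + s, by rw [mul_add, add_mul, ht, hs, add_smul]⟩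
    | mul M N _ _ h1 h2 =>
      intro α β
      choose t ht using fun γ => h1 α γ
      choose s hs using fun γ => h2 γ β
      choose d hd using fun γ => hvv α γ β
      refine ⟨∑ γ, t γ * s γ * d γ, ?_⟩
      have : e α * (M * N) * e β = ∑ γ, (e α * M * e γ) * (e γ * N * e β) := by
        have h3 : ∀ γ, (e α * M * e γ) * (e γ * N * e β) = e α * M * e γ * (N * e β) := by
          intro γ
          calc _ = e α * M * (e γ * e γ) * (N * e β) := by noncomm_ring
            _ = _ := by rw [hidem]
        simp only [h3]
        rw [← Finset.sum_mul, ← Finset.mul_sum, hsum]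
        noncomm_ring
      rw [this, Finset.sum_smul]
      refine Finset.sum_congr rfl fun γ _ => ?_
      rw [ht, hs, smul_mul_assoc, mul_smul_comm, hd, smul_smul, smul_smul, mul_assoc]
  refine semi_of_idem (ι := Fin n → Option Bool)
    (fun α => ⟨e α, tens_mem x fun i => le_mem _ _⟩) ?_ ?_ ?_
  · apply Subtype.ext
    simpa using hsum
  · intro α
    exact Subtype.ext (hidem α)
  · rintro α β ⟨r, hr⟩
    obtain ⟨t, ht⟩ := hall r hr α β
    by_cases ht0 : t = 0
    · left
      apply Subtype.ext
      simpa [ht0] using ht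
    by_cases hv : ∃ i, lv K (x i) (α i) (β i) = 0
    · left
      obtain ⟨i, hi⟩ := hv
      have : v α β = 0 := tens_zero _ i hi
      apply Subtype.ext
      simpa [this] using ht
    · right
      choose s hs using fun i => (lv_inv (hw i) (x i) (α i) (β i)).resolve_left
        (fun h => hv ⟨i, h⟩)
      refine ⟨⟨t⁻¹ • tens (fun i => s i • lv K (x i) (β i) (α i)), Subalgebra.smul_mem _
        (tens_mem x fun i => Subalgebra.smul_mem _ (lv_mem _ _ _) _) _⟩, ?_⟩
      apply Subtype.ext
      change e α * r * e β * (t⁻¹ • tens (fun i => s i • lv K (x i) (β i) (α i))) = e α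
      rw [ht, smul_mul_assoc, mul_smul_comm, smul_smul, mul_inv_cancel₀ ht0, one_smul]
      simp only [v, e, tens_mul, hs]

theorem inv_of_mem (x : ∀ i, U i) (σ : ∀ i, Equiv.Perm (U i)) (hσ : ∀ i, σ i (x i) = x i)
    {M : Matrix (∀ i, U i) (∀ i, U i) K} (hM : M ∈ TerwAlg K x) (y z) :
    M (fun i => σ i (y i)) (fun i => σ i (z i)) = M y z := by
  have hD : ∀ y z : ∀ i, U i, Dst (fun i => σ i (y i)) (fun i => σ i (z i)) = Dst y z := by
    intro y z; simp [Dst]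
  have hx : ∀ y : ∀ i, U i, Dst x (fun i => σ i (y i)) = Dst x y := by
    intro y
    conv_lhs => rw [← funext hσ]
    exact hD x y
  have hinj : ∀ y z : ∀ i, U i, ((fun i => σ i (y i)) = (fun i => σ i (z i))) ↔ y = z := by
    intro y z; simp [funext_iff]
  induction hM using Algebra.adjoin_induction generalizing y z with
  | mem M h =>
    rcases h with ⟨S, rfl⟩ | ⟨S, rfl⟩
    · simp only [adjMat, hD]
    · simp only [dualIdem, Matrix.diagonal_apply, hx, hinj]
  | algebraMap r =>
    simp only [Matrix.algebraMap_matrix_apply, hinj]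
  | add M N _ _ h1 h2 => simp only [Matrix.add_apply, h1, h2]
  | mul M N _ _ h1 h2 =>
    simp only [Matrix.mul_apply]
    rw [← (Equiv.piCongrRight σ).sum_comp]
    refine Finset.sum_congr rfl fun w _ => ?_
    exact congrArg₂ _ (h1 _ _) (h2 _ _)

theorem nsemi (x : ∀ i, U i) (i : Fin n) (hi : lw K (U i) true = 0) (z : U i) (hz : z ≠ x i) :
    ¬ IsSemisimpleRing (TerwAlg K x) := by
  intro hs
  let g : (∀ i, U i) → K := fun y => if Dst x y = {i} then 1 else 0
  let a : Matrix (∀ i, U i) (∀ i, U i) K := Matrix.vecMulVec g g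
  have ha : a ∈ TerwAlg K x := by
    have h1 : dualIdem K x {i} ∈ TerwAlg K x := Algebra.subset_adjoin (Or.inr ⟨_, rfl⟩)
    have h2 : ∑ S, adjMat K S ∈ TerwAlg K x :=
      sum_mem fun S _ => Algebra.subset_adjoin (Or.inl ⟨S, rfl⟩)
    have : a = dualIdem K x {i} * (∑ S, adjMat K S) * dualIdem K x {i} := by
      ext y z
      simp only [dualIdem, Matrix.mul_diagonal, Matrix.diagonal_mul, Matrix.sum_apply, adjMat, a, g,
        Matrix.vecMulVec_apply]
      simp
    rw [this]
    exact mul_mem (mul_mem h1 h2) h1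
  -- points of the block
  have hg : ∀ h : (∀ i, U i) → K, ∑ y, g y * h y =
      ∑ w ∈ univ.erase (x i), h (Function.update x i w) := by
    intro h
    simp only [g, ite_mul, one_mul, zero_mul]
    rw [← Finset.sum_filter]
    symm
    refine Finset.sum_bij' (fun w _ => Function.update x i w) (fun y _ => y i) ?_ ?_ ?_ ?_ ?_
    · intro w hw
      simp only [Finset.mem_erase, Finset.mem_univ, and_true] at hw
      simp only [Finset.mem_filter, Finset.mem_univ, true_and]
      unfold Dst
      ext j
      by_cases hj : j = i
      · subst hj; simp [Ne.symm hw]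
      · simp [hj]
    · intro y hy
      simp only [Finset.mem_filter, Finset.mem_univ, true_and] at hy
      unfold Dst at hy
      have : i ∈ ({i} : Finset (Fin n)) := by simp
      rw [← hy] at this
      simp at this
      simpa using Ne.symm this
    · intro w _; simp
    · intro y hy
      simp only [Finset.mem_filter, Finset.mem_univ, true_and] at hy
      unfold Dst at hy
      ext1 j
      by_cases hj : j = i
      · subst hj; simp
      · have : j ∉ ({i} : Finset (Fin n)) := by simp [hj]
        rw [← hy] at this
        simp at this
        simp [hj, this]
    · intros; rfl
  have haz : ∀ r ∈ TerwAlg K x, a * r * a = 0 := by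
    intro r hr
    have hc : ∀ w ∈ univ.erase (x i), ∑ w' ∈ univ.erase (x i),
        r (Function.update x i w) (Function.update x i w') =
        ∑ w' ∈ univ.erase (x i), r (Function.update x i z) (Function.update x i w') := by
      intro w hw
      simp only [Finset.mem_erase, Finset.mem_univ, and_true] at hw
      let τ : Equiv.Perm (U i) := Equiv.swap w z
      have hτ : τ (x i) = x i := Equiv.swap_apply_of_ne_of_ne (Ne.symm hw) (Ne.symm hz)
      let σ : ∀ j, Equiv.Perm (U j) := Function.update (fun j => 1) i τ
      have hσx : ∀ j, σ j (x j) = x j := by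
        intro j
        by_cases hj : j = i
        · subst hj; simpa [σ] using hτ
        · simp [σ, hj]
      have hσ : ∀ w, (fun j => σ j (Function.update x i w j)) = Function.update x i (τ w) := by
        intro w
        ext1 j
        by_cases hj : j = i
        · subst hj; simp [σ]
        · simp [σ, hj]
      refine Finset.sum_equiv τ ?_ ?_
      · intro w'
        simp only [Finset.mem_erase, Finset.mem_univ, and_true]
        conv_rhs => rw [← hτ]
        simp
      · intro w' _
        rw [← inv_of_mem x σ hσx hr, hσ, hσ]
        simp [τ]
    have : g ⬝ᵥ (r.mulVec g) = 0 := by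
      simp only [dotProduct, Matrix.mulVec]
      rw [hg]
      simp_rw [mul_comm (r _ _) (g _), hg]
      rw [Finset.sum_congr rfl hc, Finset.sum_const, nsmul_eq_mul]
      have : ((univ.erase (x i)).card : K) = 0 := by
        rw [Finset.card_erase_of_mem (mem_univ _), Nat.cast_sub]
        · simpa [lw] using hi
        · exact Finset.card_pos.2 ⟨x i, mem_univ _⟩
      rw [this, zero_mul]
    simp only [a]
    rw [mul_assoc, Matrix.mul_vecMulVec, Matrix.vecMulVec_mul_vecMulVec, this]
    simp
  have h0 := not_semi (R := TerwAlg K x) ⟨a, ha⟩ (fun r => Subtype.ext (haz r.1 r.2))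
  have h1 : a = 0 := congrArg Subtype.val h0
  have h2 : a (Function.update x i z) (Function.update x i z) = 1 := by
    have : Dst x (Function.update x i z) = {i} := by
      ext j
      by_cases hj : j = i
      · subst hj; simp [Dst, Ne.symm hz]
      · simp [Dst, hj]
    simp [a, g, Matrix.vecMulVec_apply, this]
  rw [h1] at h2
  simp at h2

end tens

set_option synthInstance.maxHeartbeats 1000000 in
theorem stmt_16 (hn : 1 ≤ n) (u : Fin n → ℕ) (hu : ∀ i, Fintype.card (U i) = u i)
    (h2 : ∀ i, 2 ≤ u i) (x : ∀ i, U i) (p : ℕ) (hp : CharP F p) :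
    IsSemisimpleRing ↥(TerwAlg F x) ↔ ∀ i, ¬ p ∣ (u i - 1) := by
  have hw : ∀ i, lw F (U i) true = 0 ↔ p ∣ (u i - 1) := by
    intro i
    rw [← CharP.cast_eq_zero_iff F p, Nat.cast_sub (by have := h2 i; omega), ← hu i]
    simp [lw]
  constructor
  · intro hs i hi
    have : Nontrivial (U i) := Fintype.one_lt_card_iff_nontrivial.1 (by rw [hu i]; exact h2 i)
    obtain ⟨z, hz⟩ := exists_ne (x i)
    exact nsemi x i ((hw i).2 hi) z hz hs
  · intro h
    apply semi
    intro i a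
    cases a
    · simp [lw]
    · exact fun h' => h i ((hw i).1 h')
end

section
/- The Jacobson radical of the Terwilliger F-algebra T of the factorial scheme equals the F-linear span of the matrices B_{A,B,C} over all triples of subsets (A,B,C) of {1,…,n} with A Δ B ⊆ C ⊆ (A Δ B) ∪ Q(A∩B) and with the characteristic p of F dividing k_B = ∏_{x∈B}(u_x − 1). -/
open Finset

variable {n : ℕ} {U : Fin n → Type*} [∀ i, Fintype (U i)] [∀ i, DecidableEq (U i)]
variable (F : Type*) [Field F]

/-- `B_{A,B,C} = ∑_{AΔC ⊆ b ⊆ B} E*_A A_b E*_C`. -/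
def Bmat (x : ∀ i, U i) (A B C : Finset (Fin n)) : Matrix (∀ i, U i) (∀ i, U i) F :=
  ∑ b ∈ B.powerset.filter (fun b => symmDiff A C ⊆ b),
    dualIdem F x A * adjMat F b * dualIdem F x C

/-- `k_S = ∏_{x ∈ S} (u_x - 1)`. -/
def kval (u : Fin n → ℕ) (S : Finset (Fin n)) : ℕ := ∏ i ∈ S, (u i - 1)


/-- Valid triples, coordinatewise. -/
def VT (u : Fin n → ℕ) (A B C : Finset (Fin n)) : Prop :=
  ∀ i, (i ∈ A → i ∈ B ∨ i ∈ C) ∧ (i ∈ B → i ∈ A ∨ i ∈ C) ∧ (i ∈ C → i ∈ A ∨ i ∈ B) ∧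
    (i ∈ A → i ∈ B → i ∈ C → 2 < u i)

lemma VT_iff (u : Fin n → ℕ) (A B C : Finset (Fin n)) :
    VT u A B C ↔ (symmDiff A B ⊆ C ∧ C ⊆ symmDiff A B ∪ (A ∩ B).filter (fun i => 2 < u i)) := by
  unfold VT
  simp only [Finset.subset_iff, Finset.mem_symmDiff, Finset.mem_union, Finset.mem_filter,
    Finset.mem_inter]
  constructor
  · intro h
    refine ⟨fun i hi => ?_, fun i hi => ?_⟩ <;> have := h i <;> tauto
  · rintro ⟨h1, h2⟩ i
    have := @h1 i
    have := @h2 i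
    tauto

lemma mem_Dst (y z : ∀ i, U i) (i : Fin n) : i ∈ Dst y z ↔ y i ≠ z i := by
  simp [Dst]

lemma Dst_eq_iff (y z : ∀ i, U i) (S : Finset (Fin n)) :
    Dst y z = S ↔ ∀ i, (y i ≠ z i ↔ i ∈ S) := by
  simp [Finset.ext_iff, mem_Dst]

lemma EAE_apply (x : ∀ i, U i) (A b C : Finset (Fin n)) (y z : ∀ i, U i) :
    (dualIdem F x A * adjMat F b * dualIdem F x C :
      Matrix (∀ i, U i) (∀ i, U i) F) y z =
      if Dst x y = A ∧ Dst x z = C ∧ Dst y z = b then 1 else 0 := by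
  simp only [dualIdem, Matrix.mul_diagonal, Matrix.diagonal_mul, adjMat]
  by_cases h1 : Dst x y = A <;> by_cases h2 : Dst x z = C <;> simp [h1, h2]

lemma symm_sub (x y z : ∀ i, U i) : symmDiff (Dst x y) (Dst x z) ⊆ Dst y z := by
  intro i
  simp only [Finset.mem_symmDiff, mem_Dst]
  grind

lemma Bmat_apply (x : ∀ i, U i) (A B C : Finset (Fin n)) (y z : ∀ i, U i) :
    Bmat F x A B C y z =
      if Dst x y = A ∧ Dst x z = C ∧ Dst y z ⊆ B then 1 else 0 := by
  unfold Bmat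
  rw [Matrix.sum_apply]
  simp only [EAE_apply]
  by_cases h1 : Dst x y = A
  · by_cases h2 : Dst x z = C
    · have := symm_sub x y z
      simp only [h1, h2, true_and] at *
      rw [Finset.sum_ite_eq]
      simp [this]
    · simp [h2]
  · simp [h1]

/-- Coordinate factor. -/
def gf {V : Type*} [DecidableEq V] (x0 : V) (a b c : Prop) [Decidable a] [Decidable b] [Decidable c]
    (s t : V) : F :=
  if (x0 ≠ s ↔ a) ∧ (x0 ≠ t ↔ c) ∧ (s ≠ t → b) then 1 else 0

lemma Bmat_prod (x : ∀ i, U i) (A B C : Finset (Fin n)) (y z : ∀ i, U i) :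
    Bmat F x A B C y z = ∏ i, gf F (x i) (i ∈ A) (i ∈ B) (i ∈ C) (y i) (z i) := by
  rw [Bmat_apply]
  simp only [gf]
  rw [Finset.prod_ite_zero]
  simp only [Finset.prod_const_one, Finset.mem_univ, true_implies]
  congr 1
  simp only [Dst_eq_iff, Finset.subset_iff, mem_Dst, eq_iff_iff]
  exact ⟨fun h i => ⟨h.1 i, h.2.1 i, fun hi => h.2.2 hi⟩,
    fun h => ⟨fun i => (h i).1, fun i => (h i).2.1, fun i => (h i).2.2⟩⟩

lemma card_ne {V : Type*} [Fintype V] [DecidableEq V] (x0 : V) (m : ℕ) (hm : Fintype.card V = m) :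
    (∑ t : V, if x0 ≠ t then (1 : F) else 0) = ((m - 1 : ℕ) : F) := by
  rw [Finset.sum_boole]
  congr 1
  rw [← hm, Finset.filter_ne, Finset.card_erase_of_mem (Finset.mem_univ _), Finset.card_univ]

lemma gf_mul {V : Type*} [Fintype V] [DecidableEq V] (x0 : V) (m : ℕ) (hm : Fintype.card V = m)
    (a b c b' d : Prop) [Decidable a] [Decidable b] [Decidable c] [Decidable b'] [Decidable d]
    (h1 : a → b ∨ c) (h2 : b → a ∨ c) (h3 : c → a ∨ b)
    (h1' : c → b' ∨ d) (h2' : b' → c ∨ d) (h3' : d → c ∨ b') (s r : V) :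
    ∑ t : V, gf F x0 a b c s t * gf F x0 c b' d t r =
      (if b ∧ b' ∧ c then ((m - 1 : ℕ) : F) else 1) *
        gf F x0 a ((b ∨ b') ∧ (a ∨ d)) d s r := by
  by_cases hc : c
  · by_cases hb : b
    · by_cases hb' : b'
      · rw [if_pos ⟨hb, hb', hc⟩, ← card_ne F x0 m hm, Finset.sum_mul]
        refine Finset.sum_congr rfl fun t _ => ?_
        simp only [gf, hc, hb, hb']
        grind
      · rw [Finset.sum_eq_single r]
        · simp only [gf, hc, hb, hb']
          grind
        · intro t _ ht
          simp only [gf, hc, hb, hb']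
          grind
        · simp
    · rw [Finset.sum_eq_single s]
      · simp only [gf, hc, hb]
        grind
      · intro t _ ht
        simp only [gf, hc, hb]
        grind
      · simp
  · rw [Finset.sum_eq_single x0]
    · simp only [gf, hc]
      grind
    · intro t _ ht
      simp only [gf, hc]
      grind
    · simp

lemma Bmat_mul_ne (x : ∀ i, U i) (A B C C' B' D : Finset (Fin n)) (h : C ≠ C') :
    Bmat F x A B C * Bmat F x C' B' D = 0 := by
  ext y z
  rw [Matrix.mul_apply]
  refine Finset.sum_eq_zero fun w _ => ?_
  rw [Bmat_apply, Bmat_apply]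
  grind

lemma Bmat_mul (u : Fin n → ℕ) (hu : ∀ i, Fintype.card (U i) = u i)
    (x : ∀ i, U i) (A B C B' D : Finset (Fin n)) (h : VT u A B C) (h' : VT u C B' D) :
    Bmat F x A B C * Bmat F x C B' D =
      (kval u (B ∩ B' ∩ C) : F) • Bmat F x A ((B ∪ B') ∩ (A ∪ D)) D := by
  ext y z
  rw [Matrix.mul_apply, Matrix.smul_apply, smul_eq_mul]
  simp only [Bmat_prod]
  simp only [← Finset.prod_mul_distrib]
  rw [← Fintype.prod_sum (fun i t => gf F (x i) (i ∈ A) (i ∈ B) (i ∈ C) (y i) t *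
    gf F (x i) (i ∈ C) (i ∈ B') (i ∈ D) t (z i))]
  have : (kval u (B ∩ B' ∩ C) : F) =
      ∏ i, (if i ∈ B ∧ i ∈ B' ∧ i ∈ C then ((u i - 1 : ℕ) : F) else 1) := by
    rw [kval, Nat.cast_prod, Finset.prod_ite]
    simp only [Finset.prod_const_one, mul_one]
    congr 1
    ext i; simp [and_assoc]
  rw [this, ← Finset.prod_mul_distrib]
  refine Finset.prod_congr rfl fun i _ => ?_
  rw [gf_mul F (x i) (u i) (hu i) _ _ _ _ _ (h i).1 (h i).2.1 (h i).2.2.1 (h' i).1 (h' i).2.1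
    (h' i).2.2.1]
  simp only [Finset.mem_inter, Finset.mem_union]

/-- Normalised middle set: drop coordinates of size two lying in both outer sets. -/
def nB (u : Fin n → ℕ) (A B D : Finset (Fin n)) : Finset (Fin n) :=
  B.filter (fun i => i ∈ A → i ∈ D → 2 < u i)

lemma Bmat_nB (u : Fin n → ℕ) (hu : ∀ i, Fintype.card (U i) = u i) (x : ∀ i, U i)
    (A B D : Finset (Fin n)) : Bmat F x A (nB u A B D) D = Bmat F x A B D := by
  ext y z
  rw [Bmat_apply, Bmat_apply]
  congr 1
  rw [eq_iff_iff]
  refine and_congr_right fun hA => and_congr_right fun hD => ?_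
  subst hA
  subst hD
  simp only [Finset.subset_iff, nB, Finset.mem_filter, mem_Dst]
  refine ⟨fun h i hi => (h hi).1, fun h i hi => ⟨h hi, fun h1 h3 => ?_⟩⟩
  rw [← hu, ← Finset.card_univ, Finset.two_lt_card]
  exact ⟨x i, Finset.mem_univ _, y i, Finset.mem_univ _, z i, Finset.mem_univ _, h1, h3, hi⟩

lemma VT_mul (u : Fin n → ℕ) (A B C B' D : Finset (Fin n)) (h : VT u A B C) (h' : VT u C B' D) :
    VT u A (nB u A ((B ∪ B') ∩ (A ∪ D)) D) D := by
  intro i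
  have := h i
  have := h' i
  simp only [nB, Finset.mem_filter, Finset.mem_inter, Finset.mem_union]
  grind

/-- bad coordinates -/
noncomputable def Zs (u : Fin n → ℕ) : Finset (Fin n) :=
  open Classical in univ.filter fun i => ((u i - 1 : ℕ) : F) = 0

lemma kval_eq_zero (u : Fin n → ℕ) (B : Finset (Fin n)) :
    (kval u B : F) = 0 ↔ ∃ i ∈ B, i ∈ Zs F u := by
  simp [kval, Zs, Nat.cast_prod, Finset.prod_eq_zero_iff]

noncomputable def wt (u : Fin n → ℕ) (A B C : Finset (Fin n)) : ℕ :=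
  (B ∩ A ∩ Zs F u).card + (B ∩ C ∩ Zs F u).card

def Wk (u : Fin n → ℕ) (x : ∀ i, U i) (k : ℕ) :
    Submodule F (Matrix (∀ i, U i) (∀ i, U i) F) :=
  Submodule.span F {M | ∃ A B C, VT u A B C ∧ k ≤ wt F u A B C ∧ M = Bmat F x A B C}

lemma card_as_sum (S Z : Finset (Fin n)) : (S ∩ Z).card = ∑ i ∈ Z, if i ∈ S then 1 else 0 := by
  rw [Finset.inter_comm, ← Finset.filter_mem_eq_inter, Finset.card_filter]

lemma wt_mul (u : Fin n → ℕ) (h2 : ∀ i, 2 ≤ u i) (A B C B' D : Finset (Fin n)) (h : VT u A B C) (h' : VT u C B' D)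
    (hk : (kval u (B ∩ B' ∩ C) : F) ≠ 0) :
    wt F u A B C + wt F u C B' D ≤ wt F u A (nB u A ((B ∪ B') ∩ (A ∪ D)) D) D := by
  rw [Ne, kval_eq_zero] at hk
  unfold wt
  simp only [card_as_sum, ← Finset.sum_add_distrib]
  refine Finset.sum_le_sum fun i hi => ?_
  have hn : ¬ (i ∈ B ∧ i ∈ B' ∧ i ∈ C) := fun hh => hk ⟨i, by simp [hh], hi⟩
  have h1 := h i
  have h3 := h' i
  have hz : 2 < u i := by
    by_contra hlt
    have h4 : u i = 2 := le_antisymm (not_lt.1 hlt) (h2 i)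
    simp [Zs, h4] at hi
  simp only [nB, Finset.mem_filter, Finset.mem_inter, Finset.mem_union]
  by_cases i ∈ A <;> by_cases i ∈ B <;> by_cases i ∈ C <;> by_cases i ∈ B' <;>
    by_cases i ∈ D <;> simp_all

lemma Wk_mul (u : Fin n → ℕ) (hu : ∀ i, Fintype.card (U i) = u i) (h2 : ∀ i, 2 ≤ u i) (x : ∀ i, U i) (j k : ℕ)
    (M N : Matrix (∀ i, U i) (∀ i, U i) F) (hM : M ∈ Wk F u x j) (hN : N ∈ Wk F u x k) :
    M * N ∈ Wk F u x (j + k) := by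
  have : Wk F u x j * Wk F u x k ≤ Wk F u x (j + k) := by
    unfold Wk
    rw [Submodule.span_mul_span, Submodule.span_le]
    rintro _ ⟨_, ⟨A, B, C, h, hw, rfl⟩, _, ⟨C', B', D, h', hw', rfl⟩, rfl⟩
    simp only [SetLike.mem_coe]
    by_cases hC : C = C'
    · subst hC
      rw [Bmat_mul F u hu x A B C B' D h h', ← Bmat_nB F u hu]
      by_cases hk : (kval u (B ∩ B' ∩ C) : F) = 0
      · rw [hk, zero_smul]; exact Submodule.zero_mem _
      · refine Submodule.smul_mem _ _ (Submodule.subset_span ⟨_, _, _, VT_mul u A B C B' D h h', ?_, rfl⟩)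
        exact (add_le_add hw hw').trans (wt_mul F u h2 A B C B' D h h' hk)
    · rw [Bmat_mul_ne F x A B C C' B' D hC]; exact Submodule.zero_mem _
  exact this (Submodule.mul_mem_mul hM hN)

lemma Wk_large (u : Fin n → ℕ) (x : ∀ i, U i) (M : Matrix (∀ i, U i) (∀ i, U i) F)
    (hM : M ∈ Wk F u x (2 * n + 1)) : M = 0 := by
  have : Wk F u x (2 * n + 1) = ⊥ := by
    rw [Wk, Submodule.span_eq_bot]
    rintro _ ⟨A, B, C, h, hw, rfl⟩
    have h1 := Finset.card_le_univ (B ∩ A ∩ Zs F u)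
    have h2 := Finset.card_le_univ (B ∩ C ∩ Zs F u)
    simp only [Fintype.card_fin] at h1 h2
    unfold wt at hw
    omega
  rw [this] at hM
  simpa using hM

lemma Wk_pow (u : Fin n → ℕ) (hu : ∀ i, Fintype.card (U i) = u i) (h2 : ∀ i, 2 ≤ u i) (x : ∀ i, U i)
    (M : Matrix (∀ i, U i) (∀ i, U i) F) (hM : M ∈ Wk F u x 1) (k : ℕ) :
    M ^ (k + 1) ∈ Wk F u x (k + 1) := by
  induction k with
  | zero => simpa using hM
  | succ k ih => rw [pow_succ]; exact Wk_mul F u hu h2 x _ _ _ _ ih hM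

lemma EAE_mem (u : Fin n → ℕ) (hu : ∀ i, Fintype.card (U i) = u i) (x : ∀ i, U i)
    (A C : Finset (Fin n)) (b : Finset (Fin n)) :
    dualIdem F x A * adjMat F b * dualIdem F x C ∈ Wk F u x 0 := by
  induction b using Finset.strongInduction with
  | H b ih =>
    by_cases hv : VT u A b C
    · have h1 : Bmat F x A b C ∈ Wk F u x 0 := Submodule.subset_span ⟨A, b, C, hv, by simp, rfl⟩
      have hb : b ∈ b.powerset.filter (fun b => symmDiff A C ⊆ b) := by
        simp only [Finset.mem_filter, Finset.mem_powerset, Finset.Subset.refl, true_and]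
        intro i
        have := hv i
        simp only [Finset.mem_symmDiff]
        tauto
      rw [Bmat, ← Finset.add_sum_erase _ _ hb] at h1
      refine (Submodule.add_mem_iff_left _ (Submodule.sum_mem _ fun c hc => ih c ?_)).1 h1
      simp only [Finset.mem_erase, Finset.mem_filter, Finset.mem_powerset] at hc
      exact Finset.ssubset_iff_subset_ne.2 ⟨hc.2.1, hc.1⟩
    · convert Submodule.zero_mem (Wk F u x 0)
      ext y z
      rw [EAE_apply, if_neg, Matrix.zero_apply]
      rintro ⟨rfl, rfl, rfl⟩
      apply hv
      intro i
      simp only [mem_Dst]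
      refine ⟨by grind, by grind, by grind, fun h1 h2 h3 => ?_⟩
      rw [← hu, ← Finset.card_univ, Finset.two_lt_card]
      exact ⟨x i, Finset.mem_univ _, y i, Finset.mem_univ _, z i, Finset.mem_univ _, h1, h3, h2⟩

lemma sum_dual (x : ∀ i, U i) : ∑ A, dualIdem F x A = 1 := by
  ext y z
  rw [Matrix.sum_apply]
  simp only [dualIdem, Matrix.diagonal_apply, Matrix.one_apply]
  by_cases h : y = z <;> simp [h]

lemma adj_empty : adjMat (U := U) F ∅ = 1 := by
  ext y z
  simp only [adjMat, Matrix.one_apply, Dst_eq_iff, funext_iff]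
  simp

lemma mem_Wk0_of (u : Fin n → ℕ) (hu : ∀ i, Fintype.card (U i) = u i) (x : ∀ i, U i)
    (b : Finset (Fin n)) : adjMat F b ∈ Wk F u x 0 := by
  have : adjMat F b = ∑ A, ∑ C, dualIdem F x A * adjMat F b * dualIdem F x C := by
    simp only [← Finset.mul_sum, ← Finset.sum_mul, sum_dual, one_mul, mul_one]
  rw [this]
  exact Submodule.sum_mem _ fun A _ => Submodule.sum_mem _ fun C _ => EAE_mem F u hu x A C b

lemma dual_mem_Wk0 (u : Fin n → ℕ) (hu : ∀ i, Fintype.card (U i) = u i) (x : ∀ i, U i)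
    (A : Finset (Fin n)) : dualIdem F x A ∈ Wk F u x 0 := by
  have := EAE_mem F u hu x A A ∅
  rw [adj_empty, mul_one] at this
  have h2 : dualIdem F x A * dualIdem F x A = dualIdem F x A := by
    simp [dualIdem, Matrix.diagonal_mul_diagonal]
  rwa [h2] at this

lemma Terw_le (u : Fin n → ℕ) (hu : ∀ i, Fintype.card (U i) = u i) (h2 : ∀ i, 2 ≤ u i) (x : ∀ i, U i)
    (M : Matrix (∀ i, U i) (∀ i, U i) F) (hM : M ∈ TerwAlg F x) : M ∈ Wk F u x 0 := by
  unfold TerwAlg at hM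
  have one : (1 : Matrix (∀ i, U i) (∀ i, U i) F) ∈ Wk F u x 0 := by
    rw [← adj_empty (U := U) F]; exact mem_Wk0_of F u hu x ∅
  induction hM using Algebra.adjoin_induction with
  | mem M h =>
    rcases h with ⟨b, rfl⟩ | ⟨A, rfl⟩
    · exact mem_Wk0_of F u hu x b
    · exact dual_mem_Wk0 F u hu x A
  | algebraMap r => rw [Algebra.algebraMap_eq_smul_one]; exact Submodule.smul_mem _ _ one
  | add M N _ _ h1 h3 => exact Submodule.add_mem _ h1 h3
  | mul M N _ _ h1 h3 => exact Wk_mul F u hu h2 x 0 0 M N h1 h3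

lemma Bmat_mem (x : ∀ i, U i) (A B C : Finset (Fin n)) : Bmat F x A B C ∈ TerwAlg F x := by
  unfold Bmat TerwAlg
  refine Subalgebra.sum_mem _ fun b _ => ?_
  refine mul_mem (mul_mem ?_ ?_) ?_
  · exact Algebra.subset_adjoin (Or.inr ⟨A, rfl⟩)
  · exact Algebra.subset_adjoin (Or.inl ⟨b, rfl⟩)
  · exact Algebra.subset_adjoin (Or.inr ⟨C, rfl⟩)

lemma Wk_sub (u : Fin n → ℕ) (x : ∀ i, U i) (k : ℕ)
    (M : Matrix (∀ i, U i) (∀ i, U i) F) (hM : M ∈ Wk F u x k) : M ∈ TerwAlg F x := by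
  have : Wk F u x k ≤ Subalgebra.toSubmodule (TerwAlg F x) := by
    rw [Wk, Submodule.span_le]
    rintro _ ⟨A, B, C, -, -, rfl⟩
    exact Bmat_mem F x A B C
  exact this hM

lemma span_eq_Wk (u : Fin n → ℕ) (x : ∀ i, U i) (p : ℕ) (hp : CharP F p) :
    Submodule.span F
          {M : Matrix (∀ i, U i) (∀ i, U i) F |
            ∃ A B C : Finset (Fin n), symmDiff A B ⊆ C ∧
              C ⊆ symmDiff A B ∪ (A ∩ B).filter (fun i => 2 < u i) ∧
              p ∣ kval u B ∧ M = Bmat F x A B C} = Wk F u x 1 := by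
  unfold Wk
  congr 1
  ext M
  simp only [Set.mem_ofPred_eq]
  refine exists_congr fun A => exists_congr fun B => exists_congr fun C => ?_
  rw [← and_assoc, ← VT_iff]
  refine and_congr_right fun hv => and_congr_left fun _ => ?_
  rw [← CharP.cast_eq_zero_iff F p, kval_eq_zero]
  unfold wt
  constructor
  · rintro ⟨i, hi, hz⟩
    rcases (hv i).2.1 hi with h | h
    · have : 0 < (B ∩ A ∩ Zs F u).card := Finset.card_pos.2 ⟨i, by simp [hi, h, hz]⟩
      omega
    · have : 0 < (B ∩ C ∩ Zs F u).card := Finset.card_pos.2 ⟨i, by simp [hi, h, hz]⟩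
      omega
  · intro h
    have : 0 < (B ∩ A ∩ Zs F u).card ∨ 0 < (B ∩ C ∩ Zs F u).card := by omega
    rcases this with h | h
    all_goals
      obtain ⟨i, hi⟩ := Finset.card_pos.1 h
      simp only [Finset.mem_inter] at hi
      exact ⟨i, hi.1.1, hi.2⟩

/-- coordinate vector -/
def hf {V : Type*} [DecidableEq V] (x0 e1 e2 : V) (K c : Prop) [Decidable K] [Decidable c]
    (s : V) : F :=
  if c then (if K then (if x0 ≠ s then 1 else 0) else
    ((if s = e1 then 1 else 0) - (if s = e2 then 1 else 0))) else (if x0 = s then 1 else 0)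

lemma gf_vec {V : Type*} [Fintype V] [DecidableEq V] (x0 e1 e2 : V) (m : ℕ)
    (hm : Fintype.card V = m)
    (K a b c : Prop) [Decidable K] [Decidable a] [Decidable b] [Decidable c]
    (h1 : a → b ∨ c) (h2 : b → a ∨ c) (h3 : c → a ∨ b)
    (hK : ¬ K → a ∧ c ∧ e1 ≠ e2 ∧ x0 ≠ e1 ∧ x0 ≠ e2) (s : V) :
    ∑ t : V, gf F x0 a b c s t * hf F x0 e1 e2 K c t =
      (if b → K then (if b ∧ c then ((m - 1 : ℕ) : F) else 1) else 0) *
        hf F x0 e1 e2 K a s := by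
  by_cases hc : c
  · by_cases hb : b
    · by_cases hk : K
      · rw [if_pos (fun _ => hk), if_pos ⟨hb, hc⟩, ← card_ne F x0 m hm, Finset.sum_mul]
        refine Finset.sum_congr rfl fun t _ => ?_
        simp only [gf, hf, hc, hb, hk]
        grind
      · obtain ⟨ha, -, h12, h01, h02⟩ := hK hk
        rw [if_neg (by tauto), zero_mul]
        have : ∀ t, gf F x0 a b c s t * hf F x0 e1 e2 K c t =
          (if t = e1 then (if x0 ≠ s then 1 else 0) else 0) -
            (if t = e2 then (if x0 ≠ s then 1 else 0) else 0) := by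
          intro t
          simp only [gf, hf, hc, hb, hk, ha]
          grind
        simp [this]
    · rw [Finset.sum_eq_single s]
      · simp only [gf, hf, hc, hb]
        grind
      · intro t _ ht
        simp only [gf, hc, hb]
        grind
      · simp
  · rw [Finset.sum_eq_single x0]
    · simp only [gf, hf, hc]
      grind
    · intro t _ ht
      simp only [gf, hc]
      grind
    · simp

def vv (x e1 e2 : ∀ i, U i) (K C : Finset (Fin n)) (y : ∀ i, U i) : F :=
  ∏ i, hf F (x i) (e1 i) (e2 i) (i ∈ K) (i ∈ C) (y i)

lemma Bmat_vec (u : Fin n → ℕ) (hu : ∀ i, Fintype.card (U i) = u i)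
    (x e1 e2 : ∀ i, U i) (K A B C : Finset (Fin n)) (h : VT u A B C)
    (hK : ∀ i, i ∉ K → i ∈ A ∧ i ∈ C ∧ e1 i ≠ e2 i ∧ x i ≠ e1 i ∧ x i ≠ e2 i) :
    Matrix.mulVec (Bmat F x A B C) (vv F x e1 e2 K C) =
      (if B ⊆ K then (kval u (B ∩ C) : F) else 0) • vv F x e1 e2 K A := by
  ext y
  rw [Matrix.mulVec, dotProduct, Pi.smul_apply, smul_eq_mul]
  simp only [Bmat_prod, vv]
  simp only [← Finset.prod_mul_distrib]
  rw [← Fintype.prod_sum (fun i t => gf F (x i) (i ∈ A) (i ∈ B) (i ∈ C) (y i) t *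
    hf F (x i) (e1 i) (e2 i) (i ∈ K) (i ∈ C) t)]
  have : (if B ⊆ K then (kval u (B ∩ C) : F) else 0) =
      ∏ i, (if i ∈ B → i ∈ K then (if i ∈ B ∧ i ∈ C then ((u i - 1 : ℕ) : F) else 1) else 0) := by
    rw [Finset.prod_ite_zero]
    simp only [Finset.mem_univ, true_implies, Finset.subset_iff]
    congr 1
    rw [kval, Nat.cast_prod, Finset.prod_ite]
    simp only [Finset.prod_const_one, mul_one]
    congr 1
    ext i; simp
  rw [this, ← Finset.prod_mul_distrib]
  refine Finset.prod_congr rfl fun i _ => ?_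
  exact gf_vec F (x i) (e1 i) (e2 i) (u i) (hu i) _ _ _ _ (h i).1 (h i).2.1 (h i).2.2.1 (hK i) _

lemma vv_supp (x e1 e2 : ∀ i, U i) (K C : Finset (Fin n))
    (hK : ∀ i, i ∉ K → x i ≠ e1 i ∧ x i ≠ e2 i) (y : ∀ i, U i)
    (hy : vv F x e1 e2 K C y ≠ 0) : Dst x y = C := by
  rw [vv, Finset.prod_ne_zero_iff] at hy
  rw [Dst_eq_iff]
  intro i
  have h1 := hy i (Finset.mem_univ _)
  have h2 := hK i
  unfold hf at h1
  grind

lemma Bmat_vec_ne (x e1 e2 : ∀ i, U i) (K A B C' C : Finset (Fin n)) (hC : C' ≠ C)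
    (hK : ∀ i, i ∉ K → x i ≠ e1 i ∧ x i ≠ e2 i) :
    Matrix.mulVec (Bmat F x A B C') (vv F x e1 e2 K C) = 0 := by
  ext y
  rw [Matrix.mulVec, dotProduct]
  refine Finset.sum_eq_zero fun z _ => ?_
  by_cases hz : vv F x e1 e2 K C z = 0
  · simp [hz]
  · have := vv_supp F x e1 e2 K C hK z hz
    rw [Bmat_apply, if_neg, zero_mul]
    grind

lemma vv_ne (u : Fin n → ℕ) (hu : ∀ i, Fintype.card (U i) = u i) (h2 : ∀ i, 2 ≤ u i)
    (x e1 e2 : ∀ i, U i) (K C : Finset (Fin n))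
    (hK : ∀ i, i ∉ K → e1 i ≠ e2 i) : vv F x e1 e2 K C ≠ 0 := by
  have : ∀ i, ∃ s, hf F (x i) (e1 i) (e2 i) (i ∈ K) (i ∈ C) s ≠ 0 := by
    intro i
    by_cases hc : i ∈ C
    · by_cases hk : i ∈ K
      · have : 1 < Fintype.card (U i) := by rw [hu]; exact h2 i
        obtain ⟨s, hs⟩ := Fintype.exists_ne_of_one_lt_card this (x i)
        exact ⟨s, by simp [hf, hc, hk, hs.symm]⟩
      · exact ⟨e1 i, by simp [hf, hc, hk, hK i hk]⟩
    · exact ⟨x i, by simp [hf, hc]⟩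
  choose y hy using this
  intro h0
  have := congrFun h0 y
  simp only [vv, Pi.zero_apply, Finset.prod_eq_zero_iff] at this
  obtain ⟨i, -, hi⟩ := this
  exact hy i hi

lemma exists_e (u : Fin n → ℕ) (hu : ∀ i, Fintype.card (U i) = u i) (x : ∀ i, U i) :
    ∃ e1 e2 : ∀ i, U i, ∀ i, 2 < u i → e1 i ≠ e2 i ∧ x i ≠ e1 i ∧ x i ≠ e2 i := by
  have : ∀ i, ∃ a b : U i, 2 < u i → a ≠ b ∧ x i ≠ a ∧ x i ≠ b := by
    intro i
    by_cases h : 2 < u i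
    · have h1 : 1 < (univ.erase (x i)).card := by
        rw [Finset.card_erase_of_mem (Finset.mem_univ _), Finset.card_univ, hu]; omega
      obtain ⟨a, ha, b, hb, hab⟩ := Finset.one_lt_card.1 h1
      simp only [Finset.mem_erase] at ha hb
      exact ⟨a, b, fun _ => ⟨hab, ha.1.symm, hb.1.symm⟩⟩
    · exact ⟨x i, x i, fun h' => absurd h' h⟩
  choose e1 e2 h using this
  exact ⟨e1, e2, h⟩

lemma VT_symm (u : Fin n → ℕ) (A C : Finset (Fin n)) : VT u C (symmDiff A C) A := by
  intro i
  simp only [Finset.mem_symmDiff]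
  tauto

lemma kval_ne_sub (u : Fin n → ℕ) (B B' : Finset (Fin n)) (h : B' ⊆ B) (hB : (kval u B : F) ≠ 0) :
    (kval u B' : F) ≠ 0 := by
  rw [Ne, kval_eq_zero] at *
  rintro ⟨i, hi, hz⟩
  exact hB ⟨i, h hi, hz⟩

lemma coeff_zero (u : Fin n → ℕ) (hu : ∀ i, Fintype.card (U i) = u i) (h2 : ∀ i, 2 ≤ u i)
    (x : ∀ i, U i) (c : Finset (Fin n) → Finset (Fin n) → Finset (Fin n) → F)
    (hc : ∀ A B C, ¬ VT u A B C → c A B C = 0)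
    (hJ : ∀ N ∈ TerwAlg F x, ∀ v : (∀ i, U i) → F,
      Matrix.mulVec N (Matrix.mulVec (∑ A, ∑ B, ∑ C, c A B C • Bmat F x A B C) v) = v → v = 0)
    (A C B : Finset (Fin n)) (hB : (kval u B : F) ≠ 0) : c A B C = 0 := by
  induction B using Finset.strongInduction with
  | H B ih =>
    by_cases hv : VT u A B C
    swap
    · exact hc _ _ _ hv
    obtain ⟨e1, e2, he⟩ := exists_e u hu x
    set K : Finset (Fin n) := univ.filter (fun i => ¬ (i ∈ A ∧ i ∈ C ∧ 2 < u i ∧ i ∉ B)) with hKdef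
    have hK : ∀ i, i ∉ K → i ∈ A ∧ i ∈ C ∧ e1 i ≠ e2 i ∧ x i ≠ e1 i ∧ x i ≠ e2 i := by
      intro i hi
      simp only [hKdef, Finset.mem_filter, Finset.mem_univ, true_and, not_not] at hi
      exact ⟨hi.1, hi.2.1, he i hi.2.2.1⟩
    have hK2 : ∀ i, i ∉ K → x i ≠ e1 i ∧ x i ≠ e2 i := fun i hi => (hK i hi).2.2.2
    have hsub : ∀ B', VT u A B' C → (B' ⊆ K ↔ B' ⊆ B) := by
      intro B' hv'
      simp only [Finset.subset_iff, hKdef, Finset.mem_filter, Finset.mem_univ, true_and]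
      refine forall_congr' fun i => ?_
      have := hv i
      have := hv' i
      grind
    set N := Bmat F x C (symmDiff A C) A with hN
    set v := vv F x e1 e2 K C with hvdef
    have hNv : Matrix.mulVec N (vv F x e1 e2 K A) = (kval u (symmDiff A C ∩ A) : F) • v := by
      rw [hN, Bmat_vec F u hu x e1 e2 K C _ A (VT_symm u A C)
        (fun i hi => ⟨(hK i hi).2.1, (hK i hi).1, (hK i hi).2.2⟩), if_pos]
      intro i hi
      by_contra hk
      have := hK i hk
      simp only [Finset.mem_symmDiff] at hi
      tauto
    have hterm : ∀ A' B' C', Matrix.mulVec N (Matrix.mulVec (c A' B' C' • Bmat F x A' B' C') v) =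
        if A' = A ∧ B' = B ∧ C' = C then
          (c A B C * (kval u (B ∩ C) : F) * (kval u (symmDiff A C ∩ A) : F)) • v else 0 := by
      intro A' B' C'
      rw [Matrix.smul_mulVec, Matrix.mulVec_smul]
      by_cases hC : C' = C
      swap
      · rw [hvdef, Bmat_vec_ne F x e1 e2 K A' B' C' C hC hK2]
        simp [hC]
      subst hC
      by_cases hA : A' = A
      swap
      · rw [Matrix.mulVec_mulVec, hN, Bmat_mul_ne F x _ _ _ _ _ _ (Ne.symm hA)]
        simp [hA]
      subst hA
      by_cases hv' : VT u A' B' C'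
      swap
      · rw [hc _ _ _ hv', if_neg, zero_smul]
        rintro ⟨-, rfl, -⟩
        exact hv' hv
      rw [hvdef, Bmat_vec F u hu x e1 e2 K A' B' C' hv' hK, Matrix.mulVec_smul, hNv]
      by_cases hBB : B' = B
      · subst hBB
        rw [if_pos ((hsub _ hv').2 (Finset.Subset.refl _))]
        simp [smul_smul, mul_assoc, hvdef]
      · by_cases hs : B' ⊆ K
        · rw [ih B' (Finset.ssubset_iff_subset_ne.2 ⟨(hsub _ hv').1 hs, hBB⟩)
            (kval_ne_sub F u B B' ((hsub _ hv').1 hs) hB)]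
          simp [hBB]
        · simp [hBB, hs]
    set s := c A B C * (kval u (B ∩ C) : F) * (kval u (symmDiff A C ∩ A) : F) with hs
    have htot : Matrix.mulVec N (Matrix.mulVec (∑ A, ∑ B, ∑ C, c A B C • Bmat F x A B C) v) =
        s • v := by
      simp only [Matrix.sum_mulVec, Matrix.mulVec_sum, hterm]
      rw [Finset.sum_eq_single A, Finset.sum_eq_single B, Finset.sum_eq_single C] <;> simp +contextual
    by_contra hne
    have h1 : (kval u (B ∩ C) : F) ≠ 0 := kval_ne_sub F u B _ Finset.inter_subset_left hB
    have h3 : (kval u (symmDiff A C ∩ A) : F) ≠ 0 := by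
      refine kval_ne_sub F u B _ ?_ hB
      intro i hi
      have := hv i
      simp only [Finset.mem_inter, Finset.mem_symmDiff] at hi
      tauto
    have hs0 : s ≠ 0 := mul_ne_zero (mul_ne_zero hne h1) h3
    refine vv_ne F u hu h2 x e1 e2 K C (fun i hi => (hK i hi).2.2.1)
      (hJ (s⁻¹ • N) (Subalgebra.smul_mem _ (Bmat_mem F x _ _ _) _) v ?_)
    rw [Matrix.smul_mulVec, htot, smul_smul, inv_mul_cancel₀ hs0, one_smul]

lemma Wk0_rep (u : Fin n → ℕ) (x : ∀ i, U i) (M : Matrix (∀ i, U i) (∀ i, U i) F)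
    (hM : M ∈ Wk F u x 0) :
    ∃ c : Finset (Fin n) → Finset (Fin n) → Finset (Fin n) → F,
      (∀ A B C, ¬ VT u A B C → c A B C = 0) ∧ M = ∑ A, ∑ B, ∑ C, c A B C • Bmat F x A B C := by
  classical
  unfold Wk at hM
  induction hM using Submodule.span_induction with
  | mem M h =>
    obtain ⟨A, B, C, hv, -, rfl⟩ := h
    refine ⟨fun A' B' C' => if A' = A ∧ B' = B ∧ C' = C then 1 else 0, ?_, ?_⟩
    · intro A' B' C' h
      beta_reduce
      rw [if_neg]
      rintro ⟨rfl, rfl, rfl⟩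
      exact h hv
    · rw [Finset.sum_eq_single A, Finset.sum_eq_single B, Finset.sum_eq_single C] <;>
        simp +contextual
  | zero => exact ⟨fun _ _ _ => 0, by simp, by simp⟩
  | add M N _ _ h1 h2 =>
    obtain ⟨c, hc, rfl⟩ := h1
    obtain ⟨d, hd, rfl⟩ := h2
    refine ⟨fun A B C => c A B C + d A B C, fun A B C h => by simp [hc A B C h, hd A B C h], ?_⟩
    simp only [add_smul, Finset.sum_add_distrib]
  | smul r M _ h =>
    obtain ⟨c, hc, rfl⟩ := h
    refine ⟨fun A B C => r * c A B C, fun A B C h => by simp [hc A B C h], ?_⟩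
    simp only [mul_smul, Finset.smul_sum]

set_option synthInstance.maxHeartbeats 1000000 in
theorem stmt_17 (hn : 1 ≤ n) (u : Fin n → ℕ) (hu : ∀ i, Fintype.card (U i) = u i)
    (h2 : ∀ i, 2 ≤ u i) (x : ∀ i, U i) (p : ℕ) (hp : CharP F p) :
    Subtype.val '' ((Ideal.jacobson (⊥ : Ideal ↥(TerwAlg F x))) : Set ↥(TerwAlg F x))
      = (Submodule.span F
          {M : Matrix (∀ i, U i) (∀ i, U i) F |
            ∃ A B C : Finset (Fin n), symmDiff A B ⊆ C ∧
              C ⊆ symmDiff A B ∪ (A ∩ B).filter (fun i => 2 < u i) ∧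
              p ∣ kval u B ∧ M = Bmat F x A B C} : Set (Matrix (∀ i, U i) (∀ i, U i) F)) := by
  have key := span_eq_Wk F u x p hp
  ext M
  constructor
  · rintro ⟨⟨M, hMT⟩, hM, rfl⟩
    rw [SetLike.mem_coe, Ideal.mem_jacobson_iff] at hM
    obtain ⟨c, hc, hMc⟩ := Wk0_rep F u x M (Terw_le F u hu h2 x M hMT)
    have hJ : ∀ N ∈ TerwAlg F x, ∀ v : (∀ i, U i) → F,
        Matrix.mulVec N (Matrix.mulVec (∑ A, ∑ B, ∑ C, c A B C • Bmat F x A B C) v) = v →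
          v = 0 := by
      intro N hN v hv
      rw [← hMc] at hv
      obtain ⟨z, hz⟩ := hM (-⟨N, hN⟩)
      rw [Ideal.mem_bot] at hz
      have hz' : (z : Matrix (∀ i, U i) (∀ i, U i) F) * -N * M + z - 1 = 0 :=
        congrArg Subtype.val hz
      have h4 : (z : Matrix (∀ i, U i) (∀ i, U i) F) - z * (N * M) = 1 := by
        rw [← sub_eq_zero, ← hz']; noncomm_ring
      have h5 := congrArg (fun L => Matrix.mulVec L v) h4
      simp only [Matrix.sub_mulVec, ← Matrix.mulVec_mulVec, hv, sub_self, Matrix.one_mulVec] at h5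
      exact h5.symm
    have h0 := coeff_zero F u hu h2 x c hc hJ
    simp only [SetLike.mem_coe]
    rw [hMc]
    refine Submodule.sum_mem _ fun A _ => Submodule.sum_mem _ fun B _ =>
      Submodule.sum_mem _ fun C _ => ?_
    by_cases hv : VT u A B C
    · by_cases hB : (kval u B : F) = 0
      · refine Submodule.smul_mem _ _ (Submodule.subset_span ⟨A, B, C, ?_⟩)
        rw [← and_assoc, ← VT_iff]
        exact ⟨hv, (CharP.cast_eq_zero_iff F p _).1 hB, rfl⟩
      · rw [h0 A C B hB, zero_smul]; exact Submodule.zero_mem _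
    · rw [hc A B C hv, zero_smul]; exact Submodule.zero_mem _
  · intro hM
    rw [SetLike.mem_coe, key] at hM
    refine ⟨⟨M, Wk_sub F u x 1 M hM⟩, ?_, rfl⟩
    rw [SetLike.mem_coe, Ideal.mem_jacobson_iff]
    rintro ⟨N, hN⟩
    have h1 : N * M ∈ Wk F u x 1 := by
      simpa using Wk_mul F u hu h2 x 0 1 N M (Terw_le F u hu h2 x N hN) hM
    set y : ↥(TerwAlg F x) := ⟨N, hN⟩ * ⟨M, Wk_sub F u x 1 M hM⟩ with hy
    have hnil : IsNilpotent y := by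
      refine ⟨2 * n + 1, Subtype.ext ?_⟩
      exact Wk_large F u x _ (Wk_pow F u hu h2 x (N * M) h1 (2 * n))
    obtain ⟨w, hw⟩ := hnil.isUnit_one_add
    refine ⟨((w⁻¹ : (↥(TerwAlg F x))ˣ) : ↥(TerwAlg F x)), ?_⟩
    rw [Ideal.mem_bot, mul_assoc, ← hy, sub_eq_zero]
    have h3 : ((w⁻¹ : (↥(TerwAlg F x))ˣ) : ↥(TerwAlg F x)) * (1 + y) = 1 := by
      rw [← hw]; exact w.inv_mul
    rw [mul_add, mul_one, add_comm] at h3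
    exact h3
end
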